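/- The two CCP solution triangles T1 and T2 share their Brocard points, and these are triangle centers of the reference: the unordered pair of Brocard points of T1 equals the unordered pair of Brocard points of T2, and both equal the pair {Ω1, Ω2}, where Ω1 is the point with barycentric coordinates [α/u : β/v : γ/w] and Ω2 the point with barycentric coordinates [γ/u : α/v : β/w] with respect to (A,B,C), with α = (a−b)² − (a+b)c, β = (b−c)² − (b+c)a, γ = (c−a)² − (c+a)b. -/

import Mathlib

open EuclideanGeometry

/-- The point with barycentric coordinates `[x : y : z]` with respect to `(A, B, C)`. -/
noncomputable def bary (A B C : EuclideanSpace ℝ (Fin 2)) (x y z : ℝ) :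
    EuclideanSpace ℝ (Fin 2) :=
  (x + y + z)⁻¹ • (x • A + y • B + z • C)

/-- The squared distance between two points, in terms of their barycentric coordinates. -/
theorem dist_bary_sq (A B C : EuclideanSpace ℝ (Fin 2)) {x y z x' y' z' : ℝ}
    (h : x + y + z ≠ 0) (h' : x' + y' + z' ≠ 0) :
    dist (bary A B C x y z) (bary A B C x' y' z') ^ 2 =
      -(dist B C ^ 2 * (y / (x + y + z) - y' / (x' + y' + z')) *
          (z / (x + y + z) - z' / (x' + y' + z')) +
        dist C A ^ 2 * (z / (x + y + z) - z' / (x' + y' + z')) *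
          (x / (x + y + z) - x' / (x' + y' + z')) +
        dist A B ^ 2 * (x / (x + y + z) - x' / (x' + y' + z')) *
          (y / (x + y + z) - y' / (x' + y' + z'))) := by
  have hx : x / (x + y + z) = 1 - y / (x + y + z) - z / (x + y + z) := by field_simp; ring
  have hx' : x' / (x' + y' + z') = 1 - y' / (x' + y' + z') - z' / (x' + y' + z') := by
    field_simp; ring
  simp only [EuclideanSpace.dist_eq, Fin.sum_univ_two, Real.dist_eq, sq_abs]
  repeat rw [Real.sq_sqrt (by positivity)]
  simp only [bary, PiLp.smul_apply, PiLp.add_apply, smul_eq_mul, mul_add, ← mul_assoc,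
    inv_mul_eq_div, hx, hx']
  ring

/-- Nested barycentric coordinates, for inner coordinates of nonzero sum. -/
theorem bary_bary (A B C : EuclideanSpace ℝ (Fin 2))
    {x₁ y₁ z₁ x₂ y₂ z₂ x₃ y₃ z₃ : ℝ} (h₁ : x₁ + y₁ + z₁ ≠ 0) (h₂ : x₂ + y₂ + z₂ ≠ 0)
    (h₃ : x₃ + y₃ + z₃ ≠ 0) (k l m : ℝ) :
    bary (bary A B C x₁ y₁ z₁) (bary A B C x₂ y₂ z₂) (bary A B C x₃ y₃ z₃)
        (k * (x₁ + y₁ + z₁)) (l * (x₂ + y₂ + z₂)) (m * (x₃ + y₃ + z₃)) =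
      bary A B C (k * x₁ + l * x₂ + m * x₃) (k * y₁ + l * y₂ + m * y₃)
        (k * z₁ + l * z₂ + m * z₃) := by
  have hs : k * x₁ + l * x₂ + m * x₃ + (k * y₁ + l * y₂ + m * y₃) +
      (k * z₁ + l * z₂ + m * z₃) =
      k * (x₁ + y₁ + z₁) + l * (x₂ + y₂ + z₂) + m * (x₃ + y₃ + z₃) := by ring
  simp only [bary, hs]
  congr 1
  simp only [smul_smul, mul_assoc, mul_inv_cancel₀ h₁, mul_inv_cancel₀ h₂,
    mul_inv_cancel₀ h₃, mul_one]
  module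

/-- Barycentric coordinates are homogeneous. -/
theorem bary_eq_of_proportional (A B C : EuclideanSpace ℝ (Fin 2)) {x y z x' y' z' t : ℝ}
    (ht : t ≠ 0) (hx : x = t * x') (hy : y = t * y') (hz : z = t * z') :
    bary A B C x y z = bary A B C x' y' z' := by
  subst hx hy hz
  simp only [bary, mul_smul, ← smul_add, ← mul_add, mul_inv]
  rw [smul_comm, inv_smul_smul₀ ht]

/-- The length of a chord between two points of the incircle, which consists of the points
`[p² / u : q² / v : r² / w]` with `p + q + r = 0`. -/
theorem dist_bary_incircle_sq (A B C : EuclideanSpace ℝ (Fin 2)) {u v w : ℝ}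
    (hu : 0 < u) (hv : 0 < v) (hw : 0 < w)
    (ha : dist B C = v + w) (hb : dist C A = w + u) (hc : dist A B = u + v)
    {p q r p' q' r' : ℝ} (hr : p + q + r = 0) (hr' : p' + q' + r' = 0)
    (h : p ^ 2 / u + q ^ 2 / v + r ^ 2 / w ≠ 0)
    (h' : p' ^ 2 / u + q' ^ 2 / v + r' ^ 2 / w ≠ 0) :
    dist (bary A B C (p ^ 2 / u) (q ^ 2 / v) (r ^ 2 / w))
        (bary A B C (p' ^ 2 / u) (q' ^ 2 / v) (r' ^ 2 / w)) ^ 2 =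
      4 * (p * q' - p' * q) ^ 2 / ((p ^ 2 / u + q ^ 2 / v + r ^ 2 / w) *
        (p' ^ 2 / u + q' ^ 2 / v + r' ^ 2 / w)) := by
  rw [dist_bary_sq A B C h h', ha, hb, hc]
  obtain rfl : r = -(p + q) := by linarith
  obtain rfl : r' = -(p' + q') := by linarith
  rw [eq_div_iff (mul_ne_zero h h')]
  set N := p ^ 2 / u + q ^ 2 / v + (-(p + q)) ^ 2 / w with hN
  set N' := p' ^ 2 / u + q' ^ 2 / v + (-(p' + q')) ^ 2 / w with hN'
  field_simp
  rw [hN, hN']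
  field_simp
  ring

/-- The first Brocard point of a triangle inscribed in the incircle. -/
theorem brocard_first_incircle (A B C : EuclideanSpace ℝ (Fin 2)) {u v w : ℝ}
    (hu : 0 < u) (hv : 0 < v) (hw : 0 < w)
    (ha : dist B C = v + w) (hb : dist C A = w + u) (hc : dist A B = u + v)
    {p₁ q₁ r₁ p₂ q₂ r₂ p₃ q₃ r₃ k₁₂ k₂₃ k₃₁ N₁ N₂ N₃ : ℝ} {X Y Z : EuclideanSpace ℝ (Fin 2)}
    (h₁ : p₁ + q₁ + r₁ = 0) (h₂ : p₂ + q₂ + r₂ = 0) (h₃ : p₃ + q₃ + r₃ = 0)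
    (hN₁ : N₁ = p₁ ^ 2 / u + q₁ ^ 2 / v + r₁ ^ 2 / w)
    (hN₂ : N₂ = p₂ ^ 2 / u + q₂ ^ 2 / v + r₂ ^ 2 / w)
    (hN₃ : N₃ = p₃ ^ 2 / u + q₃ ^ 2 / v + r₃ ^ 2 / w)
    (hN₁0 : N₁ ≠ 0) (hN₂0 : N₂ ≠ 0) (hN₃0 : N₃ ≠ 0)
    (hX : X = bary A B C (p₁ ^ 2 / u) (q₁ ^ 2 / v) (r₁ ^ 2 / w))
    (hY : Y = bary A B C (p₂ ^ 2 / u) (q₂ ^ 2 / v) (r₂ ^ 2 / w))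
    (hZ : Z = bary A B C (p₃ ^ 2 / u) (q₃ ^ 2 / v) (r₃ ^ 2 / w))
    (h₁₂ : k₁₂ * (p₁ * q₂ - p₂ * q₁) ^ 2 = 1) (h₂₃ : k₂₃ * (p₂ * q₃ - p₃ * q₂) ^ 2 = 1)
    (h₃₁ : k₃₁ * (p₃ * q₁ - p₁ * q₃) ^ 2 = 1) :
    bary X Y Z (1 / dist Z X ^ 2) (1 / dist X Y ^ 2) (1 / dist Y Z ^ 2) =
      bary A B C ((k₃₁ * N₃ * p₁ ^ 2 + k₁₂ * N₁ * p₂ ^ 2 + k₂₃ * N₂ * p₃ ^ 2) / u)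
        ((k₃₁ * N₃ * q₁ ^ 2 + k₁₂ * N₁ * q₂ ^ 2 + k₂₃ * N₂ * q₃ ^ 2) / v)
        ((k₃₁ * N₃ * r₁ ^ 2 + k₁₂ * N₁ * r₂ ^ 2 + k₂₃ * N₂ * r₃ ^ 2) / w) := by
  have inv_chord {k d N N' : ℝ} (h : k * d ^ 2 = 1) :
      1 / (4 * d ^ 2 / (N * N')) = 1 / 4 * (k * N * N') := by
    rw [eq_inv_of_mul_eq_one_left h, one_div_div, div_eq_mul_inv, mul_inv]
    ring
  have hXY := dist_bary_incircle_sq A B C hu hv hw ha hb hc h₁ h₂ (hN₁ ▸ hN₁0) (hN₂ ▸ hN₂0)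
  have hYZ := dist_bary_incircle_sq A B C hu hv hw ha hb hc h₂ h₃ (hN₂ ▸ hN₂0) (hN₃ ▸ hN₃0)
  have hZX := dist_bary_incircle_sq A B C hu hv hw ha hb hc h₃ h₁ (hN₃ ▸ hN₃0) (hN₁ ▸ hN₁0)
  rw [← hX, ← hY, ← hN₁, ← hN₂] at hXY
  rw [← hY, ← hZ, ← hN₂, ← hN₃] at hYZ
  rw [← hZ, ← hX, ← hN₃, ← hN₁] at hZX
  rw [hXY, hYZ, hZX, inv_chord h₁₂, inv_chord h₂₃, inv_chord h₃₁,
    bary_eq_of_proportional X Y Z (by norm_num) rfl rfl rfl, hX, hY, hZ]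
  have nested := bary_bary A B C (hN₁ ▸ hN₁0) (hN₂ ▸ hN₂0) (hN₃ ▸ hN₃0)
    (k₃₁ * N₃) (k₁₂ * N₁) (k₂₃ * N₂)
  rw [← hN₁, ← hN₂, ← hN₃] at nested
  rw [nested]
  congr 1 <;> ring

/-- Exchanging the last two vertices exchanges the last two barycentric coordinates. -/
theorem bary_swap (X Y Z : EuclideanSpace ℝ (Fin 2)) (x y z : ℝ) :
    bary X Y Z x y z = bary X Z Y x z y := by
  simp only [bary, add_right_comm]

/-- Polynomial identities between the coordinates of the vertices of a triangle inscribed in the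
incircle under which its Brocard points are `[α/u : β/v : γ/w]` and `[γ/u : α/v : β/w]`. -/
theorem brocard_pair_incircle (A B C : EuclideanSpace ℝ (Fin 2)) {u v w : ℝ}
    (hu : 0 < u) (hv : 0 < v) (hw : 0 < w)
    (ha : dist B C = v + w) (hb : dist C A = w + u) (hc : dist A B = u + v)
    {p₁ q₁ r₁ p₂ q₂ r₂ p₃ q₃ r₃ k₁₂ k₂₃ k₃₁ α β γ : ℝ} {X Y Z : EuclideanSpace ℝ (Fin 2)}
    (h₁ : p₁ + q₁ + r₁ = 0) (h₂ : p₂ + q₂ + r₂ = 0) (h₃ : p₃ + q₃ + r₃ = 0)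
    (hX : X = bary A B C (p₁ ^ 2 / u) (q₁ ^ 2 / v) (r₁ ^ 2 / w))
    (hY : Y = bary A B C (p₂ ^ 2 / u) (q₂ ^ 2 / v) (r₂ ^ 2 / w))
    (hZ : Z = bary A B C (p₃ ^ 2 / u) (q₃ ^ 2 / v) (r₃ ^ 2 / w))
    (h₁₂ : k₁₂ * (p₁ * q₂ - p₂ * q₁) ^ 2 = 1) (h₂₃ : k₂₃ * (p₂ * q₃ - p₃ * q₂) ^ 2 = 1)
    (h₃₁ : k₃₁ * (p₃ * q₁ - p₁ * q₃) ^ 2 = 1)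
    (hfirst : ∀ U V W : ℝ,
      let N₁ := p₁ ^ 2 * U + q₁ ^ 2 * V + r₁ ^ 2 * W
      let N₂ := p₂ ^ 2 * U + q₂ ^ 2 * V + r₂ ^ 2 * W
      let N₃ := p₃ ^ 2 * U + q₃ ^ 2 * V + r₃ ^ 2 * W
      k₃₁ * N₃ * p₁ ^ 2 + k₁₂ * N₁ * p₂ ^ 2 + k₂₃ * N₂ * p₃ ^ 2 = U + V + 2 * W ∧
      k₃₁ * N₃ * q₁ ^ 2 + k₁₂ * N₁ * q₂ ^ 2 + k₂₃ * N₂ * q₃ ^ 2 = 2 * U + V + W ∧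
      k₃₁ * N₃ * r₁ ^ 2 + k₁₂ * N₁ * r₂ ^ 2 + k₂₃ * N₂ * r₃ ^ 2 = U + 2 * V + W)
    (hsecond : ∀ U V W : ℝ,
      let N₁ := p₁ ^ 2 * U + q₁ ^ 2 * V + r₁ ^ 2 * W
      let N₂ := p₂ ^ 2 * U + q₂ ^ 2 * V + r₂ ^ 2 * W
      let N₃ := p₃ ^ 2 * U + q₃ ^ 2 * V + r₃ ^ 2 * W
      k₁₂ * N₂ * p₁ ^ 2 + k₃₁ * N₁ * p₃ ^ 2 + k₂₃ * N₃ * p₂ ^ 2 = U + 2 * V + W ∧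
      k₁₂ * N₂ * q₁ ^ 2 + k₃₁ * N₁ * q₃ ^ 2 + k₂₃ * N₃ * q₂ ^ 2 = U + V + 2 * W ∧
      k₁₂ * N₂ * r₁ ^ 2 + k₃₁ * N₁ * r₃ ^ 2 + k₂₃ * N₃ * r₂ ^ 2 = 2 * U + V + W)
    (hα : α = -2 * (2 * u * v + u * w + v * w))
    (hβ : β = -2 * (2 * v * w + u * v + u * w))
    (hγ : γ = -2 * (2 * u * w + u * v + v * w)) :
    bary X Y Z (1 / dist Z X ^ 2) (1 / dist X Y ^ 2) (1 / dist Y Z ^ 2) =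
        bary A B C (α / u) (β / v) (γ / w) ∧
      bary X Y Z (1 / dist X Y ^ 2) (1 / dist Y Z ^ 2) (1 / dist Z X ^ 2) =
        bary A B C (γ / u) (α / v) (β / w) := by
  have normSum_ne {p q r p' q' k : ℝ} (hr : p + q + r = 0)
      (h : k * (p * q' - p' * q) ^ 2 = 1) : p ^ 2 / u + q ^ 2 / v + r ^ 2 / w ≠ 0 := by
    intro h0
    have hp := div_nonneg (sq_nonneg p) hu.le
    have hq := div_nonneg (sq_nonneg q) hv.le
    have hr := div_nonneg (sq_nonneg r) hw.le
    have hp0 : p ^ 2 / u = 0 := by linarith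
    have hq0 : q ^ 2 / v = 0 := by linarith
    simp only [div_eq_zero_iff, hu.ne', hv.ne', or_false, pow_eq_zero_iff two_ne_zero]
      at hp0 hq0
    simp [hp0, hq0] at h
  have hN₁ := normSum_ne h₁ h₁₂
  have hN₂ := normSum_ne h₂ h₂₃
  have hN₃ := normSum_ne h₃ h₃₁
  have ht : -1 / (2 * u * v * w) ≠ 0 := by
    have : 0 < 2 * u * v * w := by positivity
    exact div_ne_zero (by norm_num) this.ne'
  constructor
  · rw [brocard_first_incircle A B C hu hv hw ha hb hc h₁ h₂ h₃ rfl rfl rfl hN₁ hN₂ hN₃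
      hX hY hZ h₁₂ h₂₃ h₃₁]
    obtain ⟨e₁, e₂, e₃⟩ := hfirst u⁻¹ v⁻¹ w⁻¹
    simp only [div_eq_mul_inv _ u, div_eq_mul_inv _ v, div_eq_mul_inv _ w, e₁, e₂, e₃]
    refine bary_eq_of_proportional A B C ht ?_ ?_ ?_ <;> simp only [hα, hβ, hγ] <;>
      field_simp <;> ring
  · rw [bary_swap X Y Z, dist_comm X Y, dist_comm Y Z, dist_comm Z X,
      brocard_first_incircle A B C hu hv hw ha hb hc h₁ h₃ h₂ rfl rfl rfl hN₁ hN₃ hN₂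
        hX hZ hY (k₁₂ := k₃₁) (k₂₃ := k₂₃) (k₃₁ := k₁₂)
        (by linear_combination h₃₁) (by linear_combination h₂₃) (by linear_combination h₁₂)]
    obtain ⟨e₁, e₂, e₃⟩ := hsecond u⁻¹ v⁻¹ w⁻¹
    simp only [div_eq_mul_inv _ u, div_eq_mul_inv _ v, div_eq_mul_inv _ w, e₁, e₂, e₃]
    refine bary_eq_of_proportional A B C ht ?_ ?_ ?_ <;> simp only [hα, hβ, hγ] <;>
      field_simp <;> ring

/-- The triangle inequality is strict for affinely independent points. -/
theorem dist_lt_dist_add_dist_of_affineIndependent {A B C : EuclideanSpace ℝ (Fin 2)}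
    (h : AffineIndependent ℝ ![A, B, C]) : dist A C < dist A B + dist B C := by
  refine lt_of_le_of_ne (dist_triangle A B C) fun h' => ?_
  exact affineIndependent_iff_not_collinear_set.mp h (dist_add_dist_eq_iff.mp h'.symm).collinear

/-- The two CCP solution triangles `T1` and `T2` share their Brocard points, and these are
triangle centers of the reference triangle `ABC`, given by the barycentric coordinates
`Ω1 = [α/u : β/v : γ/w]` and `Ω2 = [γ/u : α/v : β/w]`. -/
theorem ccp_solutions_share_brocard_points
    (A B C : EuclideanSpace ℝ (Fin 2)) (hABC : AffineIndependent ℝ ![A, B, C])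
    (a b c s u v w φ : ℝ)
    (ha : a = dist B C) (hb : b = dist C A) (hc : c = dist A B)
    (hs : s = (a + b + c) / 2)
    (hu : u = s - a) (hv : v = s - b) (hw : w = s - c)
    (hφ : φ = (1 + Real.sqrt 5) / 2)
    (V1 V2 V3 : EuclideanSpace ℝ (Fin 2))
    (hV1 : V1 = bary A B C (φ ^ 2 / u) (1 / v) ((φ - 1) ^ 2 / w))
    (hV2 : V2 = bary A B C ((φ - 2) ^ 2 / u) (1 / v) ((φ - 1) ^ 2 / w))
    (hV3 : V3 = bary A B C ((φ - 2) ^ 2 / u) ((2 * φ - 3) ^ 2 / v) ((φ - 1) ^ 2 / w))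
    (W1 W2 W3 : EuclideanSpace ℝ (Fin 2))
    (hW1 : W1 = bary A B C (1 / u) (φ ^ 2 / v) ((φ + 1) ^ 2 / w))
    (hW2 : W2 = bary A B C ((2 * φ + 1) ^ 2 / u) (φ ^ 2 / v) ((φ + 1) ^ 2 / w))
    (hW3 : W3 = bary A B C ((2 * φ + 1) ^ 2 / u) ((3 * φ + 2) ^ 2 / v) ((φ + 1) ^ 2 / w))
    (x1 y1 z1 x2 y2 z2 : ℝ)
    (hx1 : x1 = dist V2 V3) (hy1 : y1 = dist V3 V1) (hz1 : z1 = dist V1 V2)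
    (hx2 : x2 = dist W2 W3) (hy2 : y2 = dist W3 W1) (hz2 : z2 = dist W1 W2)
    (α β γ : ℝ)
    (hα : α = (a - b) ^ 2 - (a + b) * c)
    (hβ : β = (b - c) ^ 2 - (b + c) * a)
    (hγ : γ = (c - a) ^ 2 - (c + a) * b)
    (Ω1 Ω2 : EuclideanSpace ℝ (Fin 2))
    (hΩ1 : Ω1 = bary A B C (α / u) (β / v) (γ / w))
    (hΩ2 : Ω2 = bary A B C (γ / u) (α / v) (β / w)) :
    ({bary V1 V2 V3 (1 / y1 ^ 2) (1 / z1 ^ 2) (1 / x1 ^ 2),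
      bary V1 V2 V3 (1 / z1 ^ 2) (1 / x1 ^ 2) (1 / y1 ^ 2)} : Set (EuclideanSpace ℝ (Fin 2))) =
      {bary W1 W2 W3 (1 / y2 ^ 2) (1 / z2 ^ 2) (1 / x2 ^ 2),
       bary W1 W2 W3 (1 / z2 ^ 2) (1 / x2 ^ 2) (1 / y2 ^ 2)} ∧
    ({bary V1 V2 V3 (1 / y1 ^ 2) (1 / z1 ^ 2) (1 / x1 ^ 2),
      bary V1 V2 V3 (1 / z1 ^ 2) (1 / x1 ^ 2) (1 / y1 ^ 2)} : Set (EuclideanSpace ℝ (Fin 2))) =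
      {Ω1, Ω2} := by
  have hφ2 : φ ^ 2 = φ + 1 := by
    subst hφ
    linear_combination (1 / 4) * Real.sq_sqrt (show (0 : ℝ) ≤ 5 by norm_num)
  have hAC := dist_lt_dist_add_dist_of_affineIndependent hABC
  have hBA := dist_lt_dist_add_dist_of_affineIndependent
    (A := B) (B := C) (C := A) (by
      rw [affineIndependent_iff_not_collinear_set] at hABC ⊢
      convert hABC using 2
      grind)
  have hCB := dist_lt_dist_add_dist_of_affineIndependent
    (A := C) (B := A) (C := B) (by
      rw [affineIndependent_iff_not_collinear_set] at hABC ⊢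
      convert hABC using 2
      grind)
  rw [dist_comm A C, ← ha, ← hb, ← hc] at hAC
  rw [dist_comm B A, ← ha, ← hb, ← hc] at hBA
  rw [dist_comm C B, ← ha, ← hb, ← hc] at hCB
  have hu0 : 0 < u := by linarith
  have hv0 : 0 < v := by linarith
  have hw0 : 0 < w := by linarith
  have ea : a = v + w := by linarith
  have eb : b = w + u := by linarith
  have ec : c = u + v := by linarith
  have eα : α = -2 * (2 * u * v + u * w + v * w) := by rw [hα, ea, eb, ec]; ring
  have eβ : β = -2 * (2 * v * w + u * v + u * w) := by rw [hβ, ea, eb, ec]; ring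
  have eγ : γ = -2 * (2 * u * w + u * v + v * w) := by rw [hγ, ea, eb, ec]; ring
  obtain ⟨hT₁, hT₁'⟩ := brocard_pair_incircle A B C hu0 hv0 hw0 (ha ▸ ea) (hb ▸ eb) (hc ▸ ec)
    (X := V1) (Y := V2) (Z := V3)
    (p₁ := φ) (q₁ := -1) (r₁ := -(φ - 1)) (p₂ := φ - 2) (q₂ := 1) (r₂ := -(φ - 1))
    (p₃ := φ - 2) (q₃ := -(2 * φ - 3)) (r₃ := φ - 1)
    (k₁₂ := φ ^ 2 / 4) (k₂₃ := φ ^ 6 / 4) (k₃₁ := φ ^ 4 / 4)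
    (by ring) (by ring) (by ring)
    (by rw [hV1]; congr 2 <;> ring) (by rw [hV2]; congr 2 <;> ring)
    (by rw [hV3]; congr 2; ring)
    (by grind) (by grind) (by grind) (by grind) (by grind) eα eβ eγ
  obtain ⟨hT₂, hT₂'⟩ := brocard_pair_incircle A B C hu0 hv0 hw0 (ha ▸ ea) (hb ▸ eb) (hc ▸ ec)
    (X := W1) (Y := W2) (Z := W3)
    (p₁ := 1) (q₁ := φ) (r₁ := -(φ + 1)) (p₂ := 2 * φ + 1) (q₂ := -φ) (r₂ := -(φ + 1))
    (p₃ := 2 * φ + 1) (q₃ := -(3 * φ + 2)) (r₃ := φ + 1)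
    (k₁₂ := (φ - 1) ^ 6 / 4) (k₂₃ := (φ - 1) ^ 10 / 4) (k₃₁ := (φ - 1) ^ 8 / 4)
    (by ring) (by ring) (by ring)
    (by rw [hW1]; congr 2 <;> ring) (by rw [hW2]; congr 2 <;> ring)
    (by rw [hW3]; congr 2; ring)
    (by grind) (by grind) (by grind) (by grind) (by grind) eα eβ eγ
  subst hx1 hy1 hz1 hx2 hy2 hz2 hΩ1 hΩ2
  rw [hT₁, hT₁', hT₂, hT₂']
  exact ⟨rfl, rfl⟩
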